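/- arXiv:1309.4796 — 5 statements merged into one kernel-verified Lean document; each statement's English description precedes it below -/
import Mathlib

section
/- Let K ≥ 2 and n > K, let σ : {1,…,n} → {1,…,K} be a label assignment, and let X be the real matrix whose rows are indexed by unordered pairs {i,j} with 1 ≤ i < j ≤ n and whose columns are: (i) for each pair of labels k < l, the column with entry b_{ij,kl} = I( (σ_i = k and σ_j = l) or (σ_i = l and σ_j = k) ) in row {i,j}; and (ii) for each node v ∈ {1,…,n}, the column with entry c_{ij,v} = I(i = v) + I(j = v) in row {i,j}. Then the columns of X are linearly independent (X has full column rank) if and only if every community has at least two nodes, i.e., N_k = #{ i : σ_i = k } ≥ 2 for every k ∈ {1,…,K}. -/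
/-- Symmetrised block coefficients. -/
noncomputable def symCoef {n K : ℕ} (g : ({q : Fin K × Fin K // q.1 < q.2} ⊕ Fin n) → ℝ)
    (a b : Fin K) : ℝ :=
  if h : a < b then g (Sum.inl ⟨(a, b), h⟩) else
    if h : b < a then g (Sum.inl ⟨(b, a), h⟩) else 0

theorem symCoef_comm {n K : ℕ} (g : ({q : Fin K × Fin K // q.1 < q.2} ⊕ Fin n) → ℝ)
    (a b : Fin K) : symCoef g a b = symCoef g b a := by
  unfold symCoef
  rcases lt_trichotomy a b with h | h | h
  · simp [h, h.not_gt]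
  · simp [h]
  · simp [h, h.not_gt]

theorem symCoef_self {n K : ℕ} (g : ({q : Fin K × Fin K // q.1 < q.2} ⊕ Fin n) → ℝ)
    (a : Fin K) : symCoef g a a = 0 := by
  simp [symCoef]

theorem sum_symCoef {n K : ℕ} (g : ({q : Fin K × Fin K // q.1 < q.2} ⊕ Fin n) → ℝ)
    (a b : Fin K) :
    ∑ q : {q : Fin K × Fin K // q.1 < q.2}, g (Sum.inl q) *
      (if (a = q.1.1 ∧ b = q.1.2) ∨ (a = q.1.2 ∧ b = q.1.1) then (1 : ℝ) else 0)
      = symCoef g a b := by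
  unfold symCoef
  rcases lt_trichotomy a b with h | h | h
  · rw [Finset.sum_eq_single (⟨(a, b), h⟩ : {q : Fin K × Fin K // q.1 < q.2})]
    · simp [h]
    · rintro ⟨⟨c, d⟩, hq⟩ _ hne
      rw [if_neg, mul_zero]
      rintro (⟨h1, h2⟩ | ⟨h1, h2⟩)
      · apply hne; simp_all
      · simp only at h1 h2 hq; subst h1 h2; exact absurd h hq.not_gt
    · simp
  · subst h
    rw [Finset.sum_eq_zero]
    · simp
    · rintro ⟨⟨c, d⟩, hq⟩ _
      rw [if_neg, mul_zero]
      rintro (⟨h1, h2⟩ | ⟨h1, h2⟩)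
      · simp only at h1 h2 hq; rw [← h1, ← h2] at hq; exact lt_irrefl _ hq
      · simp only at h1 h2 hq; rw [← h1, ← h2] at hq; exact lt_irrefl _ hq
  · rw [Finset.sum_eq_single (⟨(b, a), h⟩ : {q : Fin K × Fin K // q.1 < q.2})]
    · simp [h, h.not_gt]
    · rintro ⟨⟨c, d⟩, hq⟩ _ hne
      rw [if_neg, mul_zero]
      rintro (⟨h1, h2⟩ | ⟨h1, h2⟩)
      · simp only at h1 h2 hq; subst h1 h2; exact absurd h hq.not_gt
      · apply hne; simp_all
    · simp

/-- The design matrix of the node-corrected stochastic blockmodel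
(after removal of the K within-community columns) has linearly independent
columns if and only if every community has at least two nodes. -/
theorem design_matrix_full_rank_iff {n K : ℕ} (hK : 2 ≤ K) (hn : K < n)
    (σ : Fin n → Fin K)
    (X : Matrix {p : Fin n × Fin n // p.1 < p.2}
      ({q : Fin K × Fin K // q.1 < q.2} ⊕ Fin n) ℝ)
    (hXb : ∀ p q, X p (Sum.inl q) =
      if (σ p.1.1 = q.1.1 ∧ σ p.1.2 = q.1.2) ∨ (σ p.1.1 = q.1.2 ∧ σ p.1.2 = q.1.1)
        then 1 else 0)
    (hXc : ∀ p v, X p (Sum.inr v) =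
      (if p.1.1 = v then 1 else 0) + (if p.1.2 = v then 1 else 0)) :
    LinearIndependent ℝ (fun c => fun p => X p c) ↔
      ∀ k : Fin K, 2 ≤ (Finset.univ.filter fun i => σ i = k).card := by
  have row : ∀ (g : ({q : Fin K × Fin K // q.1 < q.2} ⊕ Fin n) → ℝ)
      (p : {p : Fin n × Fin n // p.1 < p.2}),
      (∑ c, g c • (fun p => X p c)) p =
        symCoef g (σ p.1.1) (σ p.1.2) + (g (Sum.inr p.1.1) + g (Sum.inr p.1.2)) := by
    intro g p
    rw [Finset.sum_apply, Fintype.sum_sum_type, ← sum_symCoef]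
    simp only [Pi.smul_apply, smul_eq_mul, hXb, hXc]
    congr 1
    simp [mul_add, Finset.sum_add_distrib]
  have other : ∀ k : Fin K, ∃ l : Fin K, l ≠ k := by
    intro k
    haveI : Nontrivial (Fin K) := Fin.nontrivial_iff_two_le.mpr hK
    exact exists_ne k
  rw [Fintype.linearIndependent_iff]
  constructor
  · intro H k
    by_contra hk
    have hk1 : (Finset.univ.filter fun i => σ i = k).card ≤ 1 := by omega
    rw [Finset.card_le_one] at hk1
    let g : ({q : Fin K × Fin K // q.1 < q.2} ⊕ Fin n) → ℝ :=
      Sum.elim (fun q => if q.1.1 = k ∨ q.1.2 = k then 1 else 0)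
        (fun v => if σ v = k then -1 else 0)
    have hg : ∀ a b, a ≠ b → symCoef g a b = if a = k ∨ b = k then 1 else 0 := by
      intro a b hab
      rcases lt_or_gt_of_ne hab with h | h
      · simp [symCoef, g, h]
      · simp [symCoef, g, h, h.not_gt, or_comm]
    have h0 := H g (by
      funext p
      rw [row]
      obtain ⟨⟨i, j⟩, hij⟩ := p
      simp only at hij
      simp only [g, Sum.elim_inr, Pi.zero_apply]
      change symCoef g (σ i) (σ j) + _ = 0
      by_cases hs : σ i = σ j
      · by_cases hi : σ i = k
        · exact absurd (hk1 i (by simp [hi]) j (by simp [← hs, hi])) hij.ne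
        · rw [hs, symCoef_self]
          rw [hs] at hi
          simp [hi]
      · rw [hg _ _ hs]
        by_cases hi : σ i = k
        · have hj : σ j ≠ k := fun h => hs (hi.trans h.symm)
          simp [hi, hj]
        · by_cases hj : σ j = k <;> simp [hi, hj])
    obtain ⟨l, hl⟩ := other k
    have h1 := hg k l hl.symm
    rcases lt_or_gt_of_ne hl with h | h
    · have := h0 (Sum.inl ⟨(l, k), h⟩)
      simp [g] at this
    · have := h0 (Sum.inl ⟨(k, l), h⟩)
      simp [g] at this
  · intro hN g hg
    have e : ∀ i j, i ≠ j →
        symCoef g (σ i) (σ j) + (g (Sum.inr i) + g (Sum.inr j)) = 0 := by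
      intro i j hij
      rcases lt_or_gt_of_ne hij with h | h
      · have := row g ⟨(i, j), h⟩
        rw [hg] at this
        exact this.symm
      · have := row g ⟨(j, i), h⟩
        rw [hg] at this
        rw [symCoef_comm, add_comm (g (Sum.inr i))]
        exact this.symm
    have ex : ∀ k, ∃ i, σ i = k := by
      intro k
      have : 0 < (Finset.univ.filter fun i => σ i = k).card := by have := hN k; omega
      obtain ⟨i, hi⟩ := Finset.card_pos.mp this
      exact ⟨i, by simpa using hi⟩
    have hθ : ∀ i, g (Sum.inr i) = 0 := by
      intro i
      obtain ⟨i', hi', hne⟩ := Finset.exists_mem_ne (hN (σ i)) i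
      have hs : σ i' = σ i := by simpa using hi'
      obtain ⟨l, hl⟩ := other (σ i)
      obtain ⟨j, rfl⟩ := ex l
      have e1 := e i' i hne
      have e2 := e i j (fun h => hl (by rw [h]))
      have e3 := e i' j (fun h => hl (by rw [← h, hs]))
      rw [hs] at e1 e3
      rw [symCoef_self] at e1
      linarith
    rintro (⟨⟨a, b⟩, hab⟩ | v)
    · obtain ⟨i, rfl⟩ := ex a
      obtain ⟨j, rfl⟩ := ex b
      simp only at hab
      have e1 := e i j (fun h => hab.ne (by rw [h]))
      rw [hθ, hθ] at e1
      simpa [symCoef, hab] using e1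
    · exact hθ v
end

section
/- For any two label assignments σ̃ and σ on n nodes with K labels, Binder's loss is bounded by Hamming distance via 2·B(σ̃, σ) ≤ H(σ̃, σ)·( 2n − H(σ̃, σ) ); equivalently, B(σ̃, σ) ≤ H(σ̃, σ)·( n − H(σ̃, σ)/2 ). -/
/-- The Hamming distance between two label assignments. -/
def hammingLoss {n K : ℕ} (σ' σ : Fin n → Fin K) : ℕ :=
  (Finset.univ.filter fun i => σ' i ≠ σ i).card

/-- Binder's loss between two label assignments. -/
def binderLoss {n K : ℕ} (σ' σ : Fin n → Fin K) : ℕ :=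
  ∑ p ∈ Finset.univ.filter (fun p : Fin n × Fin n => p.1 < p.2),
    ((if σ' p.1 ≠ σ' p.2 then 1 else 0) * (if σ p.1 = σ p.2 then 1 else 0) +
      (if σ' p.1 = σ' p.2 then 1 else 0) * (if σ p.1 ≠ σ p.2 then 1 else 0))

/-- Binder's loss is bounded by Hamming distance via
`2·B(σ̃,σ) ≤ H(σ̃,σ)·(2n − H(σ̃,σ))`. -/
theorem binder_le_hamming_bound {n K : ℕ} (σtil σ : Fin n → Fin K) :
    2 * binderLoss σtil σ ≤ hammingLoss σtil σ * (2 * n - hammingLoss σtil σ) := by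
  classical
  set f : Fin n × Fin n → ℕ := fun p =>
    ((if σtil p.1 ≠ σtil p.2 then 1 else 0) * (if σ p.1 = σ p.2 then 1 else 0) +
      (if σtil p.1 = σtil p.2 then 1 else 0) * (if σ p.1 ≠ σ p.2 then 1 else 0)) with hf
  set g : Fin n → ℕ := fun i => if σtil i = σ i then 1 else 0 with hg
  have hB : binderLoss σtil σ = ∑ p : Fin n × Fin n, if p.1 < p.2 then f p else 0 := by
    rw [binderLoss, Finset.sum_filter]
  have hB' : binderLoss σtil σ = ∑ p : Fin n × Fin n, if p.2 < p.1 then f p else 0 := by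
    rw [hB]
    refine Fintype.sum_equiv (Equiv.prodComm _ _) _ _ ?_
    rintro ⟨i, j⟩
    simp only [hf, Equiv.prodComm_apply, Prod.swap_prod_mk, ne_eq, eq_comm]
  have hpt : ∀ p : Fin n × Fin n,
      (if p.1 < p.2 then f p else 0) + (if p.2 < p.1 then f p else 0) + g p.1 * g p.2 ≤ 1 := by
    rintro ⟨i, j⟩
    simp only [hf, hg]
    split_ifs <;> first | omega | simp_all
  have hsum := Finset.sum_le_sum (s := Finset.univ) (fun p _ => hpt p)
  rw [Finset.sum_add_distrib, Finset.sum_add_distrib, ← hB, ← hB'] at hsum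
  have hgg : ∑ p : Fin n × Fin n, g p.1 * g p.2 = (∑ i, g i) * ∑ i, g i := by
    rw [Fintype.sum_prod_type, Finset.sum_mul_sum]
  have hH : (∑ i, g i) + hammingLoss σtil σ = n := by
    have h := Finset.card_filter_add_card_filter_not (s := (Finset.univ : Finset (Fin n)))
      (fun i => σtil i = σ i)
    simpa [hg, hammingLoss, Finset.sum_boole] using h
  rw [hgg] at hsum
  simp only [Finset.sum_const, Finset.card_univ, Fintype.card_prod, Fintype.card_fin,
    smul_eq_mul, mul_one] at hsum
  generalize (∑ i, g i) = a at *
  generalize hammingLoss σtil σ = h at *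
  have h2 : 2 * n - h = 2 * a + h := by omega
  rw [h2]
  have h3 : n * n = (a + h) * (a + h) := by rw [hH]
  nlinarith
end

section
/- If K = 2, then for any two label assignments σ̃ and σ on n nodes with 2 labels, Binder's loss equals B(σ̃, σ) = H(σ̃, σ)·( n − H(σ̃, σ) ). -/
/-- With `K = 2` labels, Binder's loss equals
`H(σ̃,σ)·(n − H(σ̃,σ))`. -/
theorem binder_eq_hamming_two_labels {n : ℕ} (σtil σ : Fin n → Fin 2) :
    binderLoss σtil σ = hammingLoss σtil σ * (n - hammingLoss σtil σ) := by
  set D : Finset (Fin n) := Finset.univ.filter fun i => σtil i ≠ σ i with hD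
  have hH : hammingLoss σtil σ = D.card := rfl
  have hc : n - D.card = Dᶜ.card := by
    rw [Finset.card_compl, Fintype.card_fin]
  rw [hH, hc, ← Finset.card_product]
  have key : ∀ a b c d : Fin 2,
      ((if a ≠ b then 1 else 0) * (if c = d then 1 else 0) +
        (if a = b then 1 else 0) * (if c ≠ d then 1 else 0) : ℕ) =
      if ¬ (a ≠ c ↔ b ≠ d) then 1 else 0 := by decide
  have hmem : ∀ i, i ∈ D ↔ σtil i ≠ σ i := fun i => by simp [hD]
  unfold binderLoss
  simp only [key, ← hmem]
  rw [← Finset.card_filter, Finset.filter_filter]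
  clear_value D
  refine Finset.card_nbij' (fun p => if p.1 ∈ D then p else (p.2, p.1))
    (fun p => if p.1 < p.2 then p else (p.2, p.1)) ?_ ?_ ?_ ?_
  · rintro ⟨i, j⟩ h
    simp only [Finset.coe_filter, Set.mem_setOf_eq, Finset.mem_univ, true_and] at h
    by_cases hi : i ∈ D <;> by_cases hj : j ∈ D <;> simp_all
  · rintro ⟨i, j⟩ h
    simp only [Finset.mem_coe, Finset.mem_product, Finset.mem_compl] at h
    have hne : i ≠ j := by rintro rfl; exact h.2 h.1
    rcases lt_or_gt_of_ne hne with hl | hl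
    · simp [hl, h]
    · simp [hl, not_lt_of_gt hl, h]
  · rintro ⟨i, j⟩ h
    simp only [Finset.coe_filter, Set.mem_setOf_eq, Finset.mem_univ, true_and] at h
    by_cases hi : i ∈ D
    · simp [hi, h.1]
    · simp [hi, not_lt_of_gt h.1]
  · rintro ⟨i, j⟩ h
    simp only [Finset.mem_coe, Finset.mem_product, Finset.mem_compl] at h
    by_cases hl : i < j
    · simp [hl, h]
    · simp [hl, h]
end

section
/- Let τ : {1,…,n} → {1,…,K} be a canonical label assignment (i.e., ρ(τ) = τ) whose image has cardinality m. Then the number of label assignments σ' : {1,…,n} → {1,…,K} with ρ(σ') = τ equals K! / (K − m)!. -/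
/-- `firstPos σ k` is the first position at which label `k` appears in `σ`
(equal to `n` if `k` is not in the image of `σ`). -/
def firstPos {n K : ℕ} (σ : Fin n → Fin K) (k : Fin K) : ℕ :=
  (List.finRange n).findIdx (fun i => decide (σ i = k))

/-- The canonical remap `ρ(σ)`: each label is replaced by its (0-based) rank in
the order of first appearance of the labels in `σ`, i.e.
`ρ(σ)_i = #{ k ∈ image σ : firstPos σ k < firstPos σ (σ_i) }`. -/
def remap {n K : ℕ} (σ : Fin n → Fin K) (i : Fin n) : Fin K :=
  ⟨((Finset.univ.image σ).filter
      (fun k => firstPos σ k < firstPos σ (σ i))).card, by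
    have hmem : σ i ∈ Finset.univ.image σ :=
      Finset.mem_image_of_mem σ (Finset.mem_univ i)
    have hsub : (Finset.univ.image σ).filter
        (fun k => firstPos σ k < firstPos σ (σ i)) ⊆
        (Finset.univ.image σ).erase (σ i) := by
      intro k hk
      rw [Finset.mem_filter] at hk
      refine Finset.mem_erase.mpr ⟨?_, hk.1⟩
      rintro rfl
      exact lt_irrefl _ hk.2
    have h1 := Finset.card_le_card hsub
    have h2 : ((Finset.univ.image σ).erase (σ i)).card <
        (Finset.univ.image σ).card := Finset.card_erase_lt_of_mem hmem
    have h3 : (Finset.univ.image σ).card ≤ K := by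
      simpa using Finset.card_le_univ (Finset.univ.image σ)
    exact lt_of_le_of_lt h1 (lt_of_lt_of_le h2 h3)⟩

theorem firstPos_inj {n K : ℕ} (σ : Fin n → Fin K) (i j : Fin n)
    (h : firstPos σ (σ i) = firstPos σ (σ j)) : σ i = σ j := by
  have key : ∀ i : Fin n, ∃ hl : firstPos σ (σ i) < (List.finRange n).length,
      σ ((List.finRange n)[firstPos σ (σ i)]) = σ i := by
    intro i
    have hl : firstPos σ (σ i) < (List.finRange n).length := by
      unfold firstPos
      rw [List.findIdx_lt_length]
      exact ⟨i, List.mem_finRange i, by simp⟩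
    refine ⟨hl, ?_⟩
    have := List.findIdx_getElem (w := hl)
    exact of_decide_eq_true this
  obtain ⟨h1, e1⟩ := key i
  obtain ⟨h2, e2⟩ := key j
  rw [← e1, ← e2]
  simp only [h]

theorem remap_lt_aux {n K : ℕ} (σ : Fin n → Fin K) (i j : Fin n)
    (h : firstPos σ (σ i) < firstPos σ (σ j)) : remap σ i < remap σ j := by
  rw [Fin.lt_def]
  unfold remap
  dsimp only
  apply Finset.card_lt_card
  rw [Finset.ssubset_iff_of_subset]
  · refine ⟨σ i, ?_, ?_⟩
    · simp [h]
    · simp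
  · intro k hk
    rw [Finset.mem_filter] at hk ⊢
    exact ⟨hk.1, hk.2.trans h⟩

theorem remap_eq_iff {n K : ℕ} (σ : Fin n → Fin K) (i j : Fin n) :
    remap σ i = remap σ j ↔ σ i = σ j := by
  constructor
  · intro h
    apply firstPos_inj
    rcases lt_trichotomy (firstPos σ (σ i)) (firstPos σ (σ j)) with h1 | h1 | h1
    · exact absurd h (remap_lt_aux σ i j h1).ne
    · exact h1
    · exact absurd h (remap_lt_aux σ j i h1).ne'
  · intro h
    unfold remap
    simp only [h]

theorem remap_comp_val {n K : ℕ} {S : Type*} [DecidableEq S] (g : Fin n → S) (e : S ↪ Fin K)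
    (i : Fin n) :
    (remap (fun j => e (g j)) i : ℕ) = ((Finset.univ.image g).filter (fun s =>
      (List.finRange n).findIdx (fun j => decide (g j = s)) <
      (List.finRange n).findIdx (fun j => decide (g j = g i)))).card := by
  rw [← Finset.card_map e]
  unfold remap
  dsimp only
  congr 1
  ext k
  simp only [Finset.mem_filter, Finset.mem_image, Finset.mem_univ, true_and, Finset.mem_map]
  constructor
  · rintro ⟨⟨a, rfl⟩, h⟩
    refine ⟨g a, ⟨⟨a, rfl⟩, ?_⟩, rfl⟩
    simpa [firstPos] using h
  · rintro ⟨_, ⟨⟨a, rfl⟩, h⟩, rfl⟩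
    refine ⟨⟨a, rfl⟩, ?_⟩
    simpa [firstPos] using h

theorem card_fiber_aux {n K : ℕ} {S : Type*} [DecidableEq S] [Fintype S] (g : Fin n → S)
    (hg : ∀ s, ∃ i, g i = s) (e₀ : S ↪ Fin K) (τ : Fin n → Fin K)
    (hge : τ = fun j => e₀ (g j)) (hτ : remap τ = τ) :
    (Finset.univ.filter fun σ' : Fin n → Fin K => remap σ' = τ).card =
      K.descFactorial (Fintype.card S) := by
  have hc : Fintype.card (S ↪ Fin K) = K.descFactorial (Fintype.card S) := by
    rw [Fintype.card_embedding_eq, Fintype.card_fin]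
  rw [← hc, ← Finset.card_univ]
  symm
  refine Finset.card_bij (fun e _ => fun i => e (g i)) ?_ ?_ ?_
  · intro e _
    rw [Finset.mem_filter]
    refine ⟨Finset.mem_univ _, ?_⟩
    rw [← hτ, hge]
    funext i
    apply Fin.ext
    rw [remap_comp_val g e i, remap_comp_val g e₀ i]
  · intro e _ e' _ h
    ext s
    obtain ⟨i, rfl⟩ := hg s
    exact congrArg Fin.val (congrFun h i)
  · intro σ hσ
    have hσ' : remap σ = τ := (Finset.mem_filter.1 hσ).2
    choose r hr using hg
    have hk : ∀ i j, g i = g j ↔ σ i = σ j := by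
      intro i j
      rw [← remap_eq_iff, hσ', hge]
      exact e₀.injective.eq_iff.symm
    refine ⟨⟨fun s => σ (r s), ?_⟩, Finset.mem_univ _, ?_⟩
    · intro s t h
      have := (hk _ _).2 h
      rwa [hr, hr] at this
    · funext i
      exact (hk _ _).1 (hr _)

/-- If `τ` is a canonical label assignment (`ρ(τ) = τ`) whose
image has cardinality `m`, then the number of label assignments `σ'` with
`ρ(σ') = τ` equals `K! / (K − m)!`. -/
theorem card_remap_fiber {n K : ℕ} (τ : Fin n → Fin K) (hτ : remap τ = τ)
    (m : ℕ) (hm : (Finset.univ.image τ).card = m) :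
    (Finset.univ.filter fun σ' : Fin n → Fin K => remap σ' = τ).card =
      K.factorial / (K - m).factorial := by
  have hmK : m ≤ K := by
    rw [← hm]
    simpa using Finset.card_le_univ (Finset.univ.image τ)
  rw [← Nat.descFactorial_eq_div hmK]
  rw [card_fiber_aux (S := {x // x ∈ Finset.univ.image τ})
    (fun i => ⟨τ i, Finset.mem_image_of_mem τ (Finset.mem_univ i)⟩) ?_
    (Function.Embedding.subtype _) τ rfl hτ, Fintype.card_coe, hm]
  rintro ⟨x, hx⟩
  obtain ⟨i, -, rfl⟩ := Finset.mem_image.1 hx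
  exact ⟨i, rfl⟩
end

section
/- For any two label assignments σ and σ̃ on n nodes with K labels, with confusion counts n_{ab} = #{ v : σ_v = a and σ̃_v = b }, the following exact identity holds: 2·n·H(σ̃, σ) − 2·B(σ̃, σ) − H(σ̃, σ)² = A + B' + 2D, where A = Σ_{a ≠ b} n_{ab}², B' = Σ n_{ab}·n_{cd} with the sum over quadruples (a,b,c,d) of labels satisfying a ≠ b, c ≠ d, c ≠ a, and d ≠ b, and D = Σ n_{aa}·n_{bc} with the sum over triples (a,b,c) of labels satisfying a ≠ b, a ≠ c, and b ≠ c. In particular the left-hand side is nonnegative. -/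
/-- The confusion counts `n_{ab} = #{ v : σ_v = a ∧ σ̃_v = b }`. -/
def confusion {n K : ℕ} (σ σtil : Fin n → Fin K) (a b : Fin K) : ℕ :=
  (Finset.univ.filter fun v => σ v = a ∧ σtil v = b).card

lemma conf_eq {n K : ℕ} (σ τ : Fin n → Fin K) (a b : Fin K) :
    (confusion σ τ a b : ℤ) = ∑ v, if σ v = a ∧ τ v = b then 1 else 0 := by
  simp [confusion]

lemma conf_sum {n K : ℕ} (σ τ : Fin n → Fin K) (G : Fin K × Fin K → ℤ) :
    ∑ q : Fin K × Fin K, G q * (confusion σ τ q.1 q.2 : ℤ) = ∑ v, G (σ v, τ v) := by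
  simp only [conf_eq, Finset.mul_sum]
  rw [Finset.sum_comm]
  refine Finset.sum_congr rfl fun v _ => ?_
  rw [Finset.sum_eq_single (σ v, τ v)]
  · simp
  · rintro ⟨a, b⟩ _ h
    rw [if_neg, mul_zero]
    rintro ⟨rfl, rfl⟩
    exact h rfl
  · simp

lemma conf_diag {n K : ℕ} (σ τ : Fin n → Fin K) (G : Fin K → ℤ) :
    ∑ a : Fin K, G a * (confusion σ τ a a : ℤ) =
      ∑ v, if σ v = τ v then G (σ v) else 0 := by
  simp only [conf_eq, Finset.mul_sum]
  rw [Finset.sum_comm]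
  refine Finset.sum_congr rfl fun v _ => ?_
  rw [Finset.sum_eq_single (σ v)]
  · by_cases h : σ v = τ v
    · simp [h]
    · simp [h, Ne.symm h]
  · intro a _ h
    rw [if_neg, mul_zero]
    rintro ⟨rfl, _⟩
    exact h rfl
  · simp

lemma partA {n K : ℕ} (σ τ : Fin n → Fin K) :
    (∑ q ∈ Finset.univ.filter (fun q : Fin K × Fin K => q.1 ≠ q.2),
        (confusion σ τ q.1 q.2 : ℤ) ^ 2) =
    ∑ v, ∑ w, if σ v ≠ τ v ∧ σ w = σ v ∧ τ w = τ v then 1 else 0 := by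
  have h := conf_sum σ τ (fun q => if q.1 ≠ q.2 then (confusion σ τ q.1 q.2 : ℤ) else 0)
  rw [Finset.sum_filter]
  refine Eq.trans (Finset.sum_congr rfl fun q _ => ?_) (h.trans ?_)
  · split_ifs <;> ring
  · refine Finset.sum_congr rfl fun v _ => ?_
    by_cases hv : σ v = τ v
    · simp [hv]
    · simp [hv, conf_eq]

lemma partB {n K : ℕ} (σ τ : Fin n → Fin K) :
    (∑ t ∈ Finset.univ.filter
          (fun t : (Fin K × Fin K) × (Fin K × Fin K) =>
            t.1.1 ≠ t.1.2 ∧ t.2.1 ≠ t.2.2 ∧ t.2.1 ≠ t.1.1 ∧ t.2.2 ≠ t.1.2),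
        (confusion σ τ t.1.1 t.1.2 : ℤ) * confusion σ τ t.2.1 t.2.2) =
    ∑ v, ∑ w, if σ v ≠ τ v ∧ σ w ≠ τ w ∧ σ w ≠ σ v ∧ τ w ≠ τ v then 1 else 0 := by
  have h2 := fun p : Fin K × Fin K => conf_sum σ τ (fun q =>
    if p.1 ≠ p.2 ∧ q.1 ≠ q.2 ∧ q.1 ≠ p.1 ∧ q.2 ≠ p.2 then (1 : ℤ) else 0)
  have h1 := conf_sum σ τ (fun p => ∑ w,
    if p.1 ≠ p.2 ∧ σ w ≠ τ w ∧ σ w ≠ p.1 ∧ τ w ≠ p.2 then (1 : ℤ) else 0)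
  rw [Finset.sum_filter, Fintype.sum_prod_type]
  refine Eq.trans (Finset.sum_congr rfl fun p _ => ?_) h1
  rw [← h2 p, Finset.sum_mul]
  refine Finset.sum_congr rfl fun q _ => ?_
  dsimp only
  split_ifs <;> ring

lemma partD {n K : ℕ} (σ τ : Fin n → Fin K) :
    (∑ t ∈ Finset.univ.filter
          (fun t : Fin K × Fin K × Fin K =>
            t.1 ≠ t.2.1 ∧ t.1 ≠ t.2.2 ∧ t.2.1 ≠ t.2.2),
        (confusion σ τ t.1 t.1 : ℤ) * confusion σ τ t.2.1 t.2.2) =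
    ∑ v, ∑ w, if σ v = τ v ∧ σ v ≠ σ w ∧ σ v ≠ τ w ∧ σ w ≠ τ w then 1 else 0 := by
  have h2 := fun a : Fin K => conf_sum σ τ (fun q =>
    if a ≠ q.1 ∧ a ≠ q.2 ∧ q.1 ≠ q.2 then (1 : ℤ) else 0)
  have h1 := conf_diag σ τ (fun a => ∑ w,
    if a ≠ σ w ∧ a ≠ τ w ∧ σ w ≠ τ w then (1 : ℤ) else 0)
  rw [Finset.sum_filter, Fintype.sum_prod_type]
  refine Eq.trans (Finset.sum_congr rfl fun p _ => ?_) (h1.trans ?_)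
  · rw [← h2 p, Finset.sum_mul]
    refine Finset.sum_congr rfl fun q _ => ?_
    dsimp only
    split_ifs <;> ring
  · refine Finset.sum_congr rfl fun v _ => ?_
    by_cases hv : σ v = τ v
    · simp only [hv, true_and, if_true]
    · simp [hv]

lemma ham_eq {n K : ℕ} (σ τ : Fin n → Fin K) :
    (hammingLoss τ σ : ℤ) = ∑ v, if σ v ≠ τ v then 1 else 0 := by
  unfold hammingLoss
  rw [Finset.card_filter]
  push_cast
  refine Finset.sum_congr rfl fun v _ => ?_
  simp only [ne_eq, eq_comm]

lemma binder_eq {n K : ℕ} (σ τ : Fin n → Fin K) :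
    2 * (binderLoss τ σ : ℤ) =
      ∑ v, ∑ w, if (τ v = τ w ↔ σ v = σ w) then 0 else 1 := by
  have h : (binderLoss τ σ : ℤ) =
      ∑ v, ∑ w, if v < w then (if (τ v = τ w ↔ σ v = σ w) then 0 else 1) else 0 := by
    unfold binderLoss
    push_cast
    rw [Finset.sum_filter, Fintype.sum_prod_type]
    refine Finset.sum_congr rfl fun v _ => Finset.sum_congr rfl fun w _ => ?_
    by_cases h1 : τ v = τ w <;> by_cases h2 : σ v = σ w <;> simp [h1, h2]
  rw [two_mul]
  nth_rewrite 2 [h]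
  rw [Finset.sum_comm, h, ← Finset.sum_add_distrib]
  refine Finset.sum_congr rfl fun v _ => ?_
  rw [← Finset.sum_add_distrib]
  refine Finset.sum_congr rfl fun w _ => ?_
  rcases lt_trichotomy v w with h | h | h
  · simp [h, h.not_gt]
  · simp [h]
  · simp [h, h.not_gt, eq_comm]

/-- The exact identity
`2·n·H(σ̃,σ) − 2·B(σ̃,σ) − H(σ̃,σ)² = A + B' + 2D` holds, where
`A = Σ_{a≠b} n_{ab}²`, `B' = Σ_{a≠b, c≠d, c≠a, d≠b} n_{ab}·n_{cd}`, and
`D = Σ_{a≠b, a≠c, b≠c} n_{aa}·n_{bc}`; in particular the left-hand side is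
nonnegative. -/
theorem binder_hamming_exact_identity {n K : ℕ} (σ σtil : Fin n → Fin K) :
    (2 * (n : ℤ) * hammingLoss σtil σ - 2 * binderLoss σtil σ -
        (hammingLoss σtil σ : ℤ) ^ 2 =
      (∑ q ∈ Finset.univ.filter (fun q : Fin K × Fin K => q.1 ≠ q.2),
        (confusion σ σtil q.1 q.2 : ℤ) ^ 2) +
      (∑ t ∈ Finset.univ.filter
          (fun t : (Fin K × Fin K) × (Fin K × Fin K) =>
            t.1.1 ≠ t.1.2 ∧ t.2.1 ≠ t.2.2 ∧ t.2.1 ≠ t.1.1 ∧ t.2.2 ≠ t.1.2),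
        (confusion σ σtil t.1.1 t.1.2 : ℤ) * confusion σ σtil t.2.1 t.2.2) +
      2 * ∑ t ∈ Finset.univ.filter
          (fun t : Fin K × Fin K × Fin K =>
            t.1 ≠ t.2.1 ∧ t.1 ≠ t.2.2 ∧ t.2.1 ≠ t.2.2),
        (confusion σ σtil t.1 t.1 : ℤ) * confusion σ σtil t.2.1 t.2.2) ∧
    0 ≤ 2 * (n : ℤ) * hammingLoss σtil σ - 2 * binderLoss σtil σ -
        (hammingLoss σtil σ : ℤ) ^ 2 := by
  refine (fun h => ⟨h, h ▸ by positivity⟩) ?_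
  have e1 : 2 * (n : ℤ) * hammingLoss σtil σ = ∑ v : Fin n, ∑ w : Fin n,
      ((if σ v ≠ σtil v then (1 : ℤ) else 0) + (if σ w ≠ σtil w then 1 else 0)) := by
    simp only [Finset.sum_add_distrib, ham_eq, Finset.sum_const, Finset.card_univ,
      Fintype.card_fin, nsmul_eq_mul, ← Finset.mul_sum]
    ring
  have e2 : (hammingLoss σtil σ : ℤ) ^ 2 = ∑ v : Fin n, ∑ w : Fin n,
      ((if σ v ≠ σtil v then (1 : ℤ) else 0) * (if σ w ≠ σtil w then 1 else 0)) := by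
    rw [ham_eq, sq, Finset.sum_mul_sum]
  rw [e1, e2, binder_eq, partA, partB, partD, two_mul]
  conv_rhs => rw [← add_assoc]; arg 2; rw [Finset.sum_comm]
  simp only [← Finset.sum_add_distrib, ← Finset.sum_sub_distrib]
  refine Finset.sum_congr rfl fun v _ => Finset.sum_congr rfl fun w _ => ?_
  generalize σ v = a
  generalize σ w = b
  generalize σtil v = c
  generalize σtil w = d
  by_cases h1 : a = c <;> by_cases h2 : b = d <;> by_cases h3 : a = b <;>
    by_cases h4 : c = d <;> grind
end
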